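/- Let Γ ⊂ B(0,R_Γ) be a compact set, Π = ℝ² ∖ Γ, and let T : Π → {z ∈ ℂ : |z| > 1} be a holomorphic bijection of the form T(z) = βz + h(z), β ∈ ℂ ∖ {0}, h bounded holomorphic, with |T(z)| ≥ 1 on Π. Let ω₀ : ℝ² → ℝ be smooth with compact support contained in Π, and α ∈ ℝ. For each ε ∈ (0,1] let Ω_ε be a bounded open set with Γ ⊂ Ω_ε ⊂ {x : dist(x,Γ) < ε} and supp ω₀ ∩ closure(Ω_ε) = ∅, Π_ε = ℝ² ∖ closure(Ω_ε), and let T_ε : Π_ε → {z ∈ ℂ : |z| > 1} be a holomorphic bijection with |T_ε| ≥ 1 on Π_ε. Assume: (i) sup_{x ∈ Π_ε} |T_ε(x) − T(x)|/|T(x)| → 0 as ε → 0; (ii) |det D(T_ε⁻¹)(z)| ≤ M' for all |z| > 1, uniformly in ε; (iii) for every R > 0, ‖DT_ε − DT‖_{L³(B(0,R) ∩ Π_ε)} → 0 as ε → 0; (iv) there exist R₁, C₀ > 0 with |DT_ε(x)| ≤ C₀ for all ε and all x with |x| ≥ R₁. Define u₀^ε = K_{T_ε}[ω₀] + α H_{T_ε}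 on Π_ε extended by 0, and u₀ = K_T[ω₀] + α H_T on Π extended by 0. Then for every compact set Q ⊂ ℝ², ‖u₀^ε − u₀‖_{L²(Q)} → 0 as ε → 0. -/

import Mathlib

open MeasureTheory Metric Set Filter

noncomputable section

/-- counterclockwise rotation of a vector of ℝ² ≃ ℂ by a right angle: `(x₁,x₂) ↦ (-x₂,x₁)` -/
def perp (v : ℂ) : ℂ := Complex.I * v

/-- the real (euclidean) dot product on ℝ² ≃ ℂ -/
def dotR (a b : ℂ) : ℝ := a.re * b.re + a.im * b.im

/-- the transpose of a real-linear map of ℝ² ≃ ℂ, applied to a vector `w` -/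
def transApply (L : ℂ →L[ℝ] ℂ) (w : ℂ) : ℂ :=
  (dotR (L 1) w : ℂ) + (dotR (L Complex.I) w : ℂ) * Complex.I

/-- the harmonic vector field `H_T(x) = (1/2π) DT(x)^T (T(x)^⊥ / |T(x)|²)` -/
def HT (T : ℂ → ℂ) (x : ℂ) : ℂ :=
  (1 / (2 * Real.pi)) • transApply (fderiv ℝ T x) ((‖T x‖ ^ 2)⁻¹ • perp (T x))

/-- `T(y)* = T(y)/|T(y)|²` -/
def starT (T : ℂ → ℂ) (y : ℂ) : ℂ := (‖T y‖ ^ 2)⁻¹ • T y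

/-- the Biot–Savart-type operator
`K_T[ω](x) = (1/2π) DT(x)^T ∫ ((T(x)−T(y))^⊥/|T(x)−T(y)|² − (T(x)−T(y)*)^⊥/|T(x)−T(y)*|²) ω(y) dy` -/
def KT (T : ℂ → ℂ) (ω : ℂ → ℝ) (x : ℂ) : ℂ :=
  (1 / (2 * Real.pi)) • transApply (fderiv ℝ T x)
    (∫ y : ℂ, ω y • ((‖T x - T y‖ ^ 2)⁻¹ • perp (T x - T y)
      - (‖T x - starT T y‖ ^ 2)⁻¹ • perp (T x - starT T y)))

open scoped ENNReal Topology ComplexConjugate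

/-! ### The planar Biot–Savart kernel -/

/-- The kernel `w ↦ w^⊥ / |w|²`. -/
def bsKernel (w : ℂ) : ℂ := (‖w‖ ^ 2)⁻¹ • perp w

lemma bsKernel_eq (w : ℂ) : bsKernel w = Complex.I * conj (w⁻¹) := by
  rw [bsKernel, perp, Complex.inv_def, Complex.normSq_eq_norm_sq]
  simp
  ring

lemma measurable_bsKernel : Measurable bsKernel := by
  have : bsKernel = fun w => Complex.I * conj (w⁻¹) := funext bsKernel_eq
  rw [this]
  exact (Complex.continuous_conj.measurable.comp measurable_inv).const_mul _

lemma norm_bsKernel (w : ℂ) : ‖bsKernel w‖ = ‖w‖⁻¹ := by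
  simp [bsKernel_eq]

lemma norm_bsKernel_sub (a b : ℂ) : ‖bsKernel a - bsKernel b‖ = ‖a⁻¹ - b⁻¹‖ := by
  rw [bsKernel_eq, bsKernel_eq, ← mul_sub, ← map_sub]
  simp only [norm_mul, Complex.norm_I, one_mul, RCLike.norm_conj]

lemma norm_bsKernel_sub_le {a b : ℂ} {d : ℝ} (hd : 0 < d) (ha : d ≤ ‖a‖) (hb : d ≤ ‖b‖) :
    ‖bsKernel a - bsKernel b‖ ≤ ‖a - b‖ / d ^ 2 := by
  have ha0 : a ≠ 0 := norm_pos_iff.1 (hd.trans_le ha)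
  have hb0 : b ≠ 0 := norm_pos_iff.1 (hd.trans_le hb)
  rw [norm_bsKernel_sub, inv_sub_inv ha0 hb0, norm_div, norm_mul, norm_sub_rev]
  gcongr
  nlinarith

/-- The singular part `1_{|w| < δ} / |w|` of the kernel bound. -/
def singularPart (δ : ℝ) : ℂ → ℝ≥0∞ := (ball (0 : ℂ) δ).indicator fun w => ‖w‖ₑ⁻¹

lemma measurable_singularPart (δ : ℝ) : Measurable (singularPart δ) :=
  measurable_enorm.inv.indicator measurableSet_ball

lemma enorm_bsKernel_le_singularPart {a : ℂ} {δ : ℝ} (ha : ‖a‖ < δ) :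
    ‖bsKernel a‖ₑ ≤ singularPart δ a := by
  rw [singularPart, indicator_of_mem (by simpa using ha)]
  rcases eq_or_ne a 0 with rfl | h0
  · simp
  · rw [← enorm_inv h0, enorm_le_iff_norm_le, norm_bsKernel, norm_inv]

lemma enorm_bsKernel_le_singularPart' {a b : ℂ} {δ : ℝ} (ha : ‖a‖ < δ) (hb : δ ≤ ‖b‖) :
    ‖bsKernel b‖ₑ ≤ singularPart δ a := by
  rw [singularPart, indicator_of_mem (by simpa using ha)]
  rcases eq_or_ne a 0 with rfl | h0
  · simp
  · rw [← enorm_inv h0, enorm_le_iff_norm_le, norm_bsKernel, norm_inv]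
    have := norm_pos_iff.2 h0
    gcongr
    linarith

lemma enorm_bsKernel_le (a : ℂ) : ‖bsKernel a‖ₑ ≤ 1 + singularPart 1 a := by
  rcases lt_or_ge ‖a‖ 1 with h | h
  · exact (enorm_bsKernel_le_singularPart h).trans le_add_self
  · refine le_trans ?_ le_self_add
    rw [← enorm_one (G := ℂ), enorm_le_iff_norm_le, norm_bsKernel, norm_one]
    exact inv_le_one_of_one_le₀ h

lemma enorm_bsKernel_sub_le {a b : ℂ} {δ : ℝ} (hδ : 0 < δ) :
    ‖bsKernel a - bsKernel b‖ₑ ≤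
      ENNReal.ofReal (‖a - b‖ / δ ^ 2) + 2 * singularPart δ a + 2 * singularPart δ b := by
  have tri := enorm_sub_le (a := bsKernel a) (b := bsKernel b)
  rcases lt_or_ge ‖a‖ δ with ha | ha <;> rcases lt_or_ge ‖b‖ δ with hb | hb
  · calc _ ≤ _ := tri
      _ ≤ singularPart δ a + singularPart δ b :=
        add_le_add (enorm_bsKernel_le_singularPart ha) (enorm_bsKernel_le_singularPart hb)
      _ ≤ 2 * singularPart δ a + 2 * singularPart δ b := by
        rw [two_mul, two_mul]; exact add_le_add le_self_add le_self_add
      _ ≤ _ := by rw [add_assoc]; exact le_add_self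
  · calc _ ≤ _ := tri
      _ ≤ singularPart δ a + singularPart δ a :=
        add_le_add (enorm_bsKernel_le_singularPart ha) (enorm_bsKernel_le_singularPart' ha hb)
      _ ≤ _ := by rw [← two_mul]; exact le_add_self.trans le_self_add
  · calc _ ≤ _ := tri
      _ ≤ singularPart δ b + singularPart δ b :=
        add_le_add (enorm_bsKernel_le_singularPart' hb ha) (enorm_bsKernel_le_singularPart hb)
      _ ≤ _ := by rw [← two_mul]; exact le_add_self
  · rw [add_assoc]
    refine le_trans ?_ le_self_add
    rw [← ofReal_norm]
    exact ENNReal.ofReal_le_ofReal (norm_bsKernel_sub_le hδ ha hb)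

lemma lintegral_singularPart_le (δ : ℝ) :
    ∫⁻ w, singularPart δ w ≤ ENNReal.ofReal (2 * Real.pi * δ) := by
  rw [← Complex.lintegral_comp_polarCoord_symm]
  have hle : ∀ p ∈ Complex.polarCoord.target,
      ENNReal.ofReal p.1 • singularPart δ (Complex.polarCoord.symm p) ≤
        (Ioo 0 δ ×ˢ Ioo (-Real.pi) Real.pi).indicator (fun _ => (1 : ℝ≥0∞)) p := by
    intro p hp
    rw [Complex.polarCoord_target] at hp
    have hp1 : 0 < p.1 := hp.1
    have hn : ‖Complex.polarCoord.symm p‖ = p.1 := by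
      rw [Complex.norm_polarCoord_symm, abs_of_pos hp1]
    by_cases h : p.1 < δ
    · have hmem : p ∈ Ioo 0 δ ×ˢ Ioo (-Real.pi) Real.pi := ⟨⟨hp1, h⟩, hp.2⟩
      rw [indicator_of_mem hmem, singularPart,
        indicator_of_mem (by rwa [mem_ball_zero_iff, hn]), ← ofReal_norm, hn, smul_eq_mul]
      exact ENNReal.mul_inv_le_one _
    · rw [singularPart, indicator_of_notMem (by rwa [mem_ball_zero_iff, hn])]
      simp
  calc _ ≤ ∫⁻ p in Complex.polarCoord.target,
        (Ioo 0 δ ×ˢ Ioo (-Real.pi) Real.pi).indicator (fun _ => (1 : ℝ≥0∞)) p :=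
        setLIntegral_mono' Complex.polarCoord.open_target.measurableSet hle
    _ ≤ ∫⁻ p : ℝ × ℝ, (Ioo 0 δ ×ˢ Ioo (-Real.pi) Real.pi).indicator (fun _ => (1 : ℝ≥0∞)) p :=
        setLIntegral_le_lintegral _ _
    _ = ENNReal.ofReal (2 * Real.pi * δ) := by
        rw [lintegral_indicator_const (measurableSet_Ioo.prod measurableSet_Ioo), one_mul,
          Measure.volume_eq_prod, Measure.prod_prod, Real.volume_Ioo, Real.volume_Ioo,
          ← ENNReal.ofReal_mul' (by linarith [Real.pi_pos])]
        congr 1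
        ring

/-! ### Real derivatives of holomorphic maps -/

lemma fderiv_real_det {f : ℂ → ℂ} {x : ℂ} (hf : DifferentiableAt ℂ f x) :
    (fderiv ℝ f x).det = ‖deriv f x‖ ^ 2 := by
  rw [hf.fderiv_restrictScalars ℝ]
  simp [ContinuousLinearMap.det, LinearMap.det_restrictScalars, Algebra.norm_complex_eq,
    Complex.normSq_eq_norm_sq]

lemma norm_fderiv_real {f : ℂ → ℂ} {x : ℂ} (hf : DifferentiableAt ℂ f x) :
    ‖fderiv ℝ f x‖ = ‖deriv f x‖ := by
  rw [hf.fderiv_restrictScalars ℝ, ContinuousLinearMap.norm_restrictScalars,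
    norm_deriv_eq_norm_fderiv]

lemma lintegral_comp_le_of_le_deriv {U K : Set ℂ} {f : ℂ → ℂ} {M : ℝ} (hU : IsOpen U)
    (hf : DifferentiableOn ℂ f U) (hinj : InjOn f U) (hKU : K ⊆ U) (hK : MeasurableSet K)
    (hd : ∀ y ∈ U, 1 ≤ M * ‖deriv f y‖ ^ 2) (g : ℂ → ℝ≥0∞) :
    ∫⁻ y in K, g (f y) ≤ ENNReal.ofReal M * ∫⁻ z, g z := by
  have hdiff : ∀ y ∈ K, DifferentiableAt ℂ f y := fun y hy =>
    (hf y (hKU hy)).differentiableAt (hU.mem_nhds (hKU hy))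
  calc ∫⁻ y in K, g (f y)
      ≤ ∫⁻ y in K, ENNReal.ofReal M * (ENNReal.ofReal |(fderiv ℝ f y).det| * g (f y)) := by
        refine setLIntegral_mono' hK fun y hy => ?_
        rw [fderiv_real_det (hdiff y hy), abs_of_nonneg (by positivity), ← mul_assoc,
          ← ENNReal.ofReal_mul' (by positivity)]
        refine le_mul_of_one_le_left zero_le ?_
        simpa using ENNReal.ofReal_le_ofReal (hd y (hKU hy))
    _ = ENNReal.ofReal M * ∫⁻ z in f '' K, g z := by
        rw [lintegral_const_mul' _ _ ENNReal.ofReal_ne_top,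
          lintegral_image_eq_lintegral_abs_det_fderiv_mul volume hK (fun y hy =>
            ((hdiff y hy).restrictScalars ℝ).hasFDerivAt.hasFDerivWithinAt) (hinj.mono hKU)]
    _ ≤ _ := by gcongr; exact Measure.restrict_le_self

lemma lintegral_enorm_fderiv_sq {U A : Set ℂ} {f : ℂ → ℂ} (hU : IsOpen U)
    (hf : DifferentiableOn ℂ f U) (hinj : InjOn f U) (hAU : A ⊆ U) (hA : MeasurableSet A) :
    ∫⁻ y in A, ‖fderiv ℝ f y‖ₑ ^ 2 = volume (f '' A) := by
  have hdiff : ∀ y ∈ A, DifferentiableAt ℂ f y := fun y hy =>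
    (hf y (hAU hy)).differentiableAt (hU.mem_nhds (hAU hy))
  rw [← lintegral_abs_det_fderiv_eq_addHaar_image volume hA (fun y hy =>
    ((hdiff y hy).restrictScalars ℝ).hasFDerivAt.hasFDerivWithinAt) (hinj.mono hAU)]
  refine setLIntegral_congr_fun hA fun y hy => ?_
  rw [fderiv_real_det (hdiff y hy), abs_of_nonneg (by positivity), ← ofReal_norm,
    norm_fderiv_real (hdiff y hy), ENNReal.ofReal_pow (norm_nonneg _)]

/-- A bound on the Jacobian determinant of a left inverse of an injective holomorphic map is a
lower bound on its derivative. -/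
lemma one_le_mul_norm_deriv_sq {U : Set ℂ} {f g : ℂ → ℂ} {M : ℝ} (hU : IsOpen U)
    (hf : DifferentiableOn ℂ f U) (hinj : InjOn f U) (hg : ∀ y ∈ U, g (f y) = y)
    (hdet : ∀ y ∈ U, |(fderiv ℝ g (f y)).det| ≤ M) {y : ℂ} (hy : y ∈ U) :
    1 ≤ M * ‖deriv f y‖ ^ 2 := by
  have key : ∀ y ∈ U, deriv f y ≠ 0 → 1 ≤ M * ‖deriv f y‖ ^ 2 := by
    intro y hy h0
    have hs : HasStrictDerivAt f (deriv f y) y :=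
      (hf.analyticAt (hU.mem_nhds hy)).hasStrictDerivAt
    have hgd := hs.to_local_left_inverse h0 (g := g)
      (Filter.eventually_of_mem (hU.mem_nhds hy) hg)
    have := hdet y hy
    rw [fderiv_real_det hgd.hasDerivAt.differentiableAt, hgd.hasDerivAt.deriv,
      abs_of_nonneg (by positivity), norm_inv, inv_pow] at this
    have hpos : 0 < ‖deriv f y‖ ^ 2 := by positivity
    calc (1 : ℝ) = (‖deriv f y‖ ^ 2)⁻¹ * ‖deriv f y‖ ^ 2 := (inv_mul_cancel₀ hpos.ne').symm
      _ ≤ _ := by gcongr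
  have hda : AnalyticAt ℂ (deriv f) y := (hf.analyticAt (hU.mem_nhds hy)).deriv
  rcases hda.eventually_eq_zero_or_eventually_ne_zero with h | h
  · exfalso
    obtain ⟨r, hr, hball⟩ := Metric.eventually_nhds_iff_ball.1 (h.and (hU.eventually_mem hy))
    have hconst : ∀ z ∈ ball y r, f z = f y := fun z hz =>
      (convex_ball y r).is_const_of_fderivWithin_eq_zero (𝕜 := ℂ)
        (fun w hw => (hf w (hball w hw).2).mono fun v hv => (hball v hv).2)
        (fun w hw => by
          rw [fderivWithin_of_isOpen isOpen_ball hw]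
          ext
          simpa using (hball w hw).1) hz (mem_ball_self hr)
    have hmem : y + ((r / 2 : ℝ) : ℂ) ∈ ball y r := by
      simp [abs_of_pos hr, hr]
    have := hinj (hball _ hmem).2 hy (hconst _ hmem)
    simp at this
    exact hr.ne' this
  · have hlim : Tendsto (fun z => M * ‖deriv f z‖ ^ 2) (𝓝[≠] y) (𝓝 (M * ‖deriv f y‖ ^ 2)) :=
      (((hda.continuousAt.norm.pow 2).const_mul M).tendsto).mono_left nhdsWithin_le_nhds
    refine ge_of_tendsto hlim ?_
    filter_upwards [h, mem_nhdsWithin_of_mem_nhds (hU.mem_nhds hy)] with z hz hzU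
    exact key z hzU hz

/-! ### The potential factor of the velocity -/

/-- The quantitative properties of a conformal map on a compact set `K` that control the
Biot–Savart integral over `K`. -/
structure ControlledOn (K : Set ℂ) (M q : ℝ) (T : ℂ → ℂ) : Prop where
  continuousOn : ContinuousOn T K
  lintegral_comp_le : ∀ g : ℂ → ℝ≥0∞, ∫⁻ y in K, g (T y) ≤ ENNReal.ofReal M * ∫⁻ z, g z
  le_norm : ∀ y ∈ K, q ≤ ‖T y‖

/-- The integrand of `KT`, at a point whose image under `T` is `a`. -/
def bsIntegrand (T : ℂ → ℂ) (ω : ℂ → ℝ) (a y : ℂ) : ℂ :=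
  ω y • (bsKernel (a - T y) - bsKernel (a - starT T y))

/-- The vector to which `DT(x)^T / 2π` is applied in `K_T[ω](x) + α H_T(x)`. -/
def potentialFactor (T : ℂ → ℂ) (ω : ℂ → ℝ) (α : ℝ) (x : ℂ) : ℂ :=
  (∫ y, bsIntegrand T ω (T x) y) + α • bsKernel (T x)

lemma transApply_add (L : ℂ →L[ℝ] ℂ) (v w : ℂ) :
    transApply L (v + w) = transApply L v + transApply L w := by
  apply Complex.ext <;> simp [transApply, dotR] <;> ring

lemma transApply_smul (L : ℂ →L[ℝ] ℂ) (c : ℝ) (w : ℂ) :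
    transApply L (c • w) = c • transApply L w := by
  apply Complex.ext <;> simp [transApply, dotR] <;> ring

lemma transApply_sub_left (L L' : ℂ →L[ℝ] ℂ) (w : ℂ) :
    transApply (L - L') w = transApply L w - transApply L' w := by
  apply Complex.ext <;> simp [transApply, dotR] <;> ring

lemma transApply_sub (L : ℂ →L[ℝ] ℂ) (v w : ℂ) :
    transApply L (v - w) = transApply L v - transApply L w := by
  apply Complex.ext <;> simp [transApply, dotR] <;> ring

lemma abs_dotR_le (a b : ℂ) : |dotR a b| ≤ ‖a‖ * ‖b‖ := by
  have : dotR a b = (a * conj b).re := by simp [dotR]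
  rw [this]
  simpa using Complex.abs_re_le_norm (a * conj b)

lemma norm_transApply_le (L : ℂ →L[ℝ] ℂ) (w : ℂ) : ‖transApply L w‖ ≤ 2 * (‖L‖ * ‖w‖) := by
  have h1 : |dotR (L 1) w| ≤ ‖L‖ * ‖w‖ :=
    (abs_dotR_le _ _).trans (by gcongr; simpa using L.le_opNorm 1)
  have h2 : |dotR (L Complex.I) w| ≤ ‖L‖ * ‖w‖ :=
    (abs_dotR_le _ _).trans (by gcongr; simpa using L.le_opNorm Complex.I)
  calc ‖transApply L w‖ ≤ |dotR (L 1) w| + |dotR (L Complex.I) w| := by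
        refine (norm_add_le _ _).trans (le_of_eq ?_)
        simp
    _ ≤ _ := by linarith

lemma velocity_eq (T : ℂ → ℂ) (ω : ℂ → ℝ) (α : ℝ) (x : ℂ) :
    KT T ω x + α • HT T x =
      (1 / (2 * Real.pi)) • transApply (fderiv ℝ T x) (potentialFactor T ω α x) := by
  rw [potentialFactor, transApply_add, transApply_smul, smul_add, smul_comm _ α]
  rfl

lemma norm_starT (T : ℂ → ℂ) (y : ℂ) : ‖starT T y‖ = ‖T y‖⁻¹ := by
  rw [← norm_bsKernel]
  simp [bsKernel, perp, starT]

lemma norm_starT_sub (T T' : ℂ → ℂ) (y : ℂ) :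
    ‖starT T' y - starT T y‖ = ‖bsKernel (T' y) - bsKernel (T y)‖ := by
  have h : ∀ S : ℂ → ℂ, bsKernel (S y) = Complex.I * starT S y := fun S => by
    simp only [bsKernel, perp, starT, Complex.real_smul]; ring
  rw [h, h, ← mul_sub, norm_mul, Complex.norm_I, one_mul]

section Estimates

variable {K : Set ℂ} {M q W : ℝ} {ω : ℂ → ℝ}

lemma ControlledOn.le_norm_sub_starT {T : ℂ → ℂ} (hT : ControlledOn K M q T) (hq : 1 < q)
    {a y : ℂ} (ha : 1 ≤ ‖a‖) (hy : y ∈ K) : 1 - q⁻¹ ≤ ‖a - starT T y‖ := by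
  have h1 : ‖starT T y‖ ≤ q⁻¹ := by
    rw [norm_starT]
    exact inv_anti₀ (by linarith) (hT.le_norm y hy)
  have := norm_sub_norm_le a (starT T y)
  linarith

lemma ControlledOn.lintegral_singularPart_le {T : ℂ → ℂ} (hT : ControlledOn K M q T) (δ : ℝ)
    (a : ℂ) :
    ∫⁻ y in K, singularPart δ (a - T y) ≤
      ENNReal.ofReal M * ENNReal.ofReal (2 * Real.pi * δ) := by
  refine (hT.lintegral_comp_le fun z => singularPart δ (a - z)).trans ?_
  rw [lintegral_sub_left_eq_self]
  gcongr
  exact _root_.lintegral_singularPart_le δ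

lemma ControlledOn.aemeasurable {T : ℂ → ℂ} (hT : ControlledOn K M q T) (hK : IsCompact K) :
    AEMeasurable T (volume.restrict K) :=
  hT.continuousOn.aemeasurable hK.measurableSet

lemma ControlledOn.aemeasurable_singularPart {T : ℂ → ℂ} (hT : ControlledOn K M q T)
    (hK : IsCompact K) (δ : ℝ) (a : ℂ) :
    AEMeasurable (fun y => singularPart δ (a - T y)) (volume.restrict K) :=
  (measurable_singularPart δ).comp_aemeasurable ((hT.aemeasurable hK).const_sub a)

lemma ControlledOn.aestronglyMeasurable_bsIntegrand {T : ℂ → ℂ} (hT : ControlledOn K M q T)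
    (hK : IsCompact K) (hω : Continuous ω) (a : ℂ) :
    AEStronglyMeasurable (bsIntegrand T ω a) (volume.restrict K) := by
  have hTm := hT.aemeasurable hK
  have hs : AEMeasurable (starT T) (volume.restrict K) :=
    ((hTm.norm.pow_const 2).inv).smul hTm
  refine hω.aestronglyMeasurable.smul (AEMeasurable.aestronglyMeasurable ?_)
  exact (measurable_bsKernel.comp_aemeasurable (hTm.const_sub a)).sub
    (measurable_bsKernel.comp_aemeasurable (hs.const_sub a))

lemma ControlledOn.lintegral_bsIntegrand_le {T : ℂ → ℂ} (hT : ControlledOn K M q T)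
    (hK : IsCompact K) (hq : 1 < q) (hM : 0 ≤ M) (hW : ∀ y, ‖ω y‖ ≤ W) {a : ℂ} (ha : 1 ≤ ‖a‖) :
    ∫⁻ y in K, ‖bsIntegrand T ω a y‖ₑ ≤
      ENNReal.ofReal (W * (volume.real K + M * (2 * Real.pi) +
        (1 - q⁻¹)⁻¹ * volume.real K)) := by
  have hW0 : 0 ≤ W := (norm_nonneg _).trans (hW 0)
  have hd : 0 < 1 - q⁻¹ := sub_pos.2 (inv_lt_one_of_one_lt₀ hq)
  have hpi := Real.pi_pos
  calc ∫⁻ y in K, ‖bsIntegrand T ω a y‖ₑ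
      ≤ ∫⁻ y in K, ENNReal.ofReal W *
          (1 + singularPart 1 (a - T y) + ENNReal.ofReal (1 - q⁻¹)⁻¹) := by
        refine setLIntegral_mono' hK.measurableSet fun y hy => ?_
        rw [bsIntegrand, enorm_smul]
        gcongr
        · rw [← ofReal_norm]
          exact ENNReal.ofReal_le_ofReal (hW y)
        · refine enorm_sub_le.trans (add_le_add (enorm_bsKernel_le _) ?_)
          rw [← ofReal_norm, norm_bsKernel]
          exact ENNReal.ofReal_le_ofReal (inv_anti₀ hd (hT.le_norm_sub_starT hq ha hy))
    _ = ENNReal.ofReal W * (volume K + (∫⁻ y in K, singularPart 1 (a - T y)) +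
          ENNReal.ofReal (1 - q⁻¹)⁻¹ * volume K) := by
        rw [lintegral_const_mul' _ _ ENNReal.ofReal_ne_top,
          lintegral_add_right _ measurable_const, lintegral_add_left measurable_const,
          lintegral_const, lintegral_const, Measure.restrict_apply_univ, one_mul]
    _ ≤ ENNReal.ofReal W * (volume K + ENNReal.ofReal M * ENNReal.ofReal (2 * Real.pi * 1) +
          ENNReal.ofReal (1 - q⁻¹)⁻¹ * volume K) := by
        gcongr
        exact hT.lintegral_singularPart_le 1 a
    _ = _ := by
        rw [← ofReal_measureReal (hK.measure_lt_top.ne), ← ENNReal.ofReal_mul hM,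
          ← ENNReal.ofReal_mul (by positivity), ← ENNReal.ofReal_add (by positivity)
          (by positivity), ← ENNReal.ofReal_add (by positivity) (by positivity),
          ← ENNReal.ofReal_mul hW0, mul_one]

lemma ControlledOn.integrable_bsIntegrand {T : ℂ → ℂ} (hT : ControlledOn K M q T)
    (hK : IsCompact K) (hq : 1 < q) (hM : 0 ≤ M) (hω : Continuous ω)
    (hW : ∀ y, ‖ω y‖ ≤ W) {a : ℂ} (ha : 1 ≤ ‖a‖) :
    IntegrableOn (bsIntegrand T ω a) K :=
  ⟨hT.aestronglyMeasurable_bsIntegrand hK hω a,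
    (hT.lintegral_bsIntegrand_le hK hq hM hW ha).trans_lt ENNReal.ofReal_lt_top⟩

lemma setIntegral_bsIntegrand (hωK : ∀ y ∉ K, ω y = 0) (T : ℂ → ℂ) (a : ℂ) :
    ∫ y in K, bsIntegrand T ω a y = ∫ y, bsIntegrand T ω a y :=
  setIntegral_eq_integral_of_forall_compl_eq_zero fun y hy => by simp [bsIntegrand, hωK y hy]

lemma ControlledOn.norm_potentialFactor_le {T : ℂ → ℂ} (hT : ControlledOn K M q T)
    (hK : IsCompact K) (hq : 1 < q) (hM : 0 ≤ M) (hωK : ∀ y ∉ K, ω y = 0)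
    (hW : ∀ y, ‖ω y‖ ≤ W) (α : ℝ) {x : ℂ} (hx : 1 ≤ ‖T x‖) :
    ‖potentialFactor T ω α x‖ ≤
      W * (volume.real K + M * (2 * Real.pi) + (1 - q⁻¹)⁻¹ * volume.real K) + |α| := by
  have hW0 : 0 ≤ W := (norm_nonneg _).trans (hW 0)
  have hd : 0 < 1 - q⁻¹ := sub_pos.2 (inv_lt_one_of_one_lt₀ hq)
  have hpi := Real.pi_pos
  refine (norm_add_le _ _).trans (add_le_add ?_ ?_)
  · rw [← setIntegral_bsIntegrand hωK, ← ENNReal.ofReal_le_ofReal_iff (by positivity),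
      ofReal_norm]
    exact (enorm_integral_le_lintegral_enorm _).trans
      (hT.lintegral_bsIntegrand_le hK hq hM hW hx)
  · rw [norm_smul, norm_bsKernel, Real.norm_eq_abs]
    exact mul_le_of_le_one_right (abs_nonneg _) (inv_le_one_of_one_le₀ hx)

lemma norm_potentialFactor_sub_le {T T' : ℂ → ℂ} (hT : ControlledOn K M q T)
    (hT' : ControlledOn K M q T') (hK : IsCompact K) (hq : 1 < q) (hM : 0 ≤ M)
    (hω : Continuous ω) (hωK : ∀ y ∉ K, ω y = 0) (hW : ∀ y, ‖ω y‖ ≤ W) (α : ℝ) {x : ℂ}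
    (hx : 1 ≤ ‖T x‖) (hx' : 1 ≤ ‖T' x‖) {s δ : ℝ} (hδ : 0 < δ)
    (hxs : ‖T' x - T x‖ ≤ s) (hs : ∀ y ∈ K, ‖T' y - T y‖ ≤ s) :
    ‖potentialFactor T' ω α x - potentialFactor T ω α x‖ ≤
      W * ((2 * s / δ ^ 2 + 2 * s / (1 - q⁻¹) ^ 2) * volume.real K +
        4 * (M * (2 * Real.pi * δ))) + |α| * s := by
  have hW0 : 0 ≤ W := (norm_nonneg _).trans (hW 0)
  have hd : 0 < 1 - q⁻¹ := sub_pos.2 (inv_lt_one_of_one_lt₀ hq)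
  have hpi := Real.pi_pos
  have hs0 : 0 ≤ s := (norm_nonneg _).trans hxs
  have hdiff : potentialFactor T' ω α x - potentialFactor T ω α x =
      (∫ y in K, (bsIntegrand T' ω (T' x) y - bsIntegrand T ω (T x) y)) +
        α • (bsKernel (T' x) - bsKernel (T x)) := by
    rw [integral_sub (hT'.integrable_bsIntegrand hK hq hM hω hW hx')
      (hT.integrable_bsIntegrand hK hq hM hω hW hx), setIntegral_bsIntegrand hωK,
      setIntegral_bsIntegrand hωK, potentialFactor, potentialFactor, smul_sub]
    ring
  have hpoint : ∀ y ∈ K, ‖bsIntegrand T' ω (T' x) y - bsIntegrand T ω (T x) y‖ₑ ≤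
      ENNReal.ofReal W * (ENNReal.ofReal (2 * s / δ ^ 2 + 2 * s / (1 - q⁻¹) ^ 2) +
        2 * (singularPart δ (T' x - T' y) + singularPart δ (T x - T y))) := by
    intro y hy
    have hrew : bsIntegrand T' ω (T' x) y - bsIntegrand T ω (T x) y =
        ω y • ((bsKernel (T' x - T' y) - bsKernel (T x - T y)) -
          (bsKernel (T' x - starT T' y) - bsKernel (T x - starT T y))) := by
      rw [bsIntegrand, bsIntegrand, ← smul_sub]
      congr 1
      ring
    have h1 : ‖bsKernel (T' x - T' y) - bsKernel (T x - T y)‖ₑ ≤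
        ENNReal.ofReal (2 * s / δ ^ 2) +
          2 * (singularPart δ (T' x - T' y) + singularPart δ (T x - T y)) := by
      refine (enorm_bsKernel_sub_le hδ).trans ?_
      rw [mul_add, ← add_assoc]
      gcongr
      calc ‖T' x - T' y - (T x - T y)‖ = ‖(T' x - T x) - (T' y - T y)‖ := by congr 1; ring
        _ ≤ ‖T' x - T x‖ + ‖T' y - T y‖ := norm_sub_le _ _
        _ ≤ 2 * s := by linarith [hs y hy]
    have h2 : ‖bsKernel (T' x - starT T' y) - bsKernel (T x - starT T y)‖ₑ ≤
        ENNReal.ofReal (2 * s / (1 - q⁻¹) ^ 2) := by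
      rw [← ofReal_norm]
      refine ENNReal.ofReal_le_ofReal ((norm_bsKernel_sub_le hd
        (hT'.le_norm_sub_starT hq hx' hy) (hT.le_norm_sub_starT hq hx hy)).trans ?_)
      gcongr
      have h3 : ‖starT T' y - starT T y‖ ≤ s := by
        rw [norm_starT_sub]
        refine (norm_bsKernel_sub_le one_pos (hq.le.trans (hT'.le_norm y hy))
          (hq.le.trans (hT.le_norm y hy))).trans ?_
        simpa using hs y hy
      calc ‖T' x - starT T' y - (T x - starT T y)‖
          = ‖(T' x - T x) - (starT T' y - starT T y)‖ := by congr 1; ring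
        _ ≤ ‖T' x - T x‖ + ‖starT T' y - starT T y‖ := norm_sub_le _ _
        _ ≤ 2 * s := by linarith
    rw [hrew, enorm_smul]
    gcongr
    · rw [← ofReal_norm]
      exact ENNReal.ofReal_le_ofReal (hW y)
    · refine (enorm_sub_le.trans (add_le_add h1 h2)).trans (le_of_eq ?_)
      rw [ENNReal.ofReal_add (by positivity) (by positivity)]
      ring
  rw [hdiff]
  refine (norm_add_le _ _).trans (add_le_add ?_ ?_)
  · rw [← ENNReal.ofReal_le_ofReal_iff (by positivity), ofReal_norm]
    calc _ ≤ ∫⁻ y in K, ‖bsIntegrand T' ω (T' x) y - bsIntegrand T ω (T x) y‖ₑ :=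
          enorm_integral_le_lintegral_enorm _
      _ ≤ _ := setLIntegral_mono' hK.measurableSet hpoint
      _ = ENNReal.ofReal W * (ENNReal.ofReal (2 * s / δ ^ 2 + 2 * s / (1 - q⁻¹) ^ 2) *
            volume K + 2 * ((∫⁻ y in K, singularPart δ (T' x - T' y)) +
              ∫⁻ y in K, singularPart δ (T x - T y))) := by
          rw [lintegral_const_mul' _ _ ENNReal.ofReal_ne_top, lintegral_add_left measurable_const,
            lintegral_const_mul' _ _ (by simp),
            lintegral_add_left' (hT'.aemeasurable_singularPart hK δ _), lintegral_const,
            Measure.restrict_apply_univ]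
      _ ≤ ENNReal.ofReal W * (ENNReal.ofReal (2 * s / δ ^ 2 + 2 * s / (1 - q⁻¹) ^ 2) *
            volume K + 2 * (ENNReal.ofReal M * ENNReal.ofReal (2 * Real.pi * δ) +
              ENNReal.ofReal M * ENNReal.ofReal (2 * Real.pi * δ))) := by
          gcongr
          · exact hT'.lintegral_singularPart_le δ _
          · exact hT.lintegral_singularPart_le δ _
      _ = _ := by
          rw [← ofReal_measureReal (hK.measure_lt_top.ne), ← ENNReal.ofReal_mul hM,
            ← ENNReal.ofReal_mul (by positivity), ← two_mul, ← mul_assoc,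
            show (2 * 2 : ℝ≥0∞) = ENNReal.ofReal 4 by norm_num,
            ← ENNReal.ofReal_mul (by positivity),
            ← ENNReal.ofReal_add (by positivity) (by positivity), ← ENNReal.ofReal_mul hW0]
  · rw [norm_smul, Real.norm_eq_abs]
    gcongr
    refine (norm_bsKernel_sub_le one_pos hx' hx).trans ?_
    simpa using hxs

lemma exists_norm_potentialFactor_sub_le (hK : IsCompact K) (hq : 1 < q) (hM : 0 ≤ M)
    (hω : Continuous ω) (hωK : ∀ y ∉ K, ω y = 0) (hW : ∀ y, ‖ω y‖ ≤ W) (α : ℝ) {η : ℝ}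
    (hη : 0 < η) :
    ∃ s > 0, ∀ T T' : ℂ → ℂ, ControlledOn K M q T → ControlledOn K M q T' → ∀ x,
      1 ≤ ‖T x‖ → 1 ≤ ‖T' x‖ → ‖T' x - T x‖ ≤ s → (∀ y ∈ K, ‖T' y - T y‖ ≤ s) →
        ‖potentialFactor T' ω α x - potentialFactor T ω α x‖ ≤ η := by
  obtain ⟨δ, hδη, hδ⟩ : ∃ δ, W * (4 * (M * (2 * Real.pi * δ))) < η ∧ 0 < δ := by
    have hc : Tendsto (fun δ : ℝ => W * (4 * (M * (2 * Real.pi * δ)))) (𝓝[>] 0)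
        (𝓝 (W * (4 * (M * (2 * Real.pi * 0))))) :=
      (Continuous.tendsto (by fun_prop) 0).mono_left nhdsWithin_le_nhds
    exact ((hc.eventually_lt_const (by simpa using hη)).and self_mem_nhdsWithin).exists
  obtain ⟨s, hsη, hs⟩ : ∃ s, W * ((2 * s / δ ^ 2 + 2 * s / (1 - q⁻¹) ^ 2) * volume.real K +
        4 * (M * (2 * Real.pi * δ))) + |α| * s < η ∧ 0 < s := by
    have hc : Tendsto (fun s : ℝ => W * ((2 * s / δ ^ 2 + 2 * s / (1 - q⁻¹) ^ 2) *
        volume.real K + 4 * (M * (2 * Real.pi * δ))) + |α| * s) (𝓝[>] 0)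
        (𝓝 (W * ((2 * 0 / δ ^ 2 + 2 * 0 / (1 - q⁻¹) ^ 2) *
        volume.real K + 4 * (M * (2 * Real.pi * δ))) + |α| * 0)) :=
      (Continuous.tendsto (by fun_prop) 0).mono_left nhdsWithin_le_nhds
    exact ((hc.eventually_lt_const (by simpa using hδη)).and self_mem_nhdsWithin).exists
  exact ⟨s, hs, fun T T' hT hT' x hx hx' hxs hsK =>
    (norm_potentialFactor_sub_le hT hT' hK hq hM hω hωK hW α hx hx' hδ hxs hsK).trans hsη.le⟩

end Estimates

/-! ### Convergence of the conformal maps and of their derivatives -/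

lemma closure_subset_cthickening_of_subset {Γ S : Set ℂ} {ε : ℝ}
    (h : S ⊆ {x : ℂ | ∃ y ∈ Γ, dist x y < ε}) : closure S ⊆ cthickening ε Γ :=
  (closure_mono fun _ hx => mem_thickening_iff.2 (h hx)).trans
    (closure_thickening_subset_cthickening ε Γ)

lemma eventually_subset_compl_closure {Γ K : Set ℂ} {Ω : ℝ → Set ℂ} (hΓ : IsCompact Γ)
    (hΩ : ∀ ε ∈ Ioc (0 : ℝ) 1, Ω ε ⊆ {x : ℂ | ∃ y ∈ Γ, dist x y < ε}) (hK : IsCompact K)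
    (hKΓ : K ⊆ Γᶜ) : ∀ᶠ ε in 𝓝[Ioc 0 1] (0 : ℝ), K ⊆ (closure (Ω ε))ᶜ := by
  obtain ⟨δ, hδ, hdisj⟩ := (disjoint_left.2 fun x hx hx' => hKΓ hx' hx :
    Disjoint Γ K).exists_cthickenings hΓ hK.isClosed
  filter_upwards [self_mem_nhdsWithin, mem_nhdsWithin_of_mem_nhds (Iio_mem_nhds hδ)]
    with ε hε hεδ y hy hy'
  exact disjoint_left.1 hdisj (cthickening_mono (le_of_lt hεδ) _
    (closure_subset_cthickening_of_subset (hΩ ε hε) hy')) (self_subset_cthickening _ hy)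

lemma tendsto_volume_cthickening_diff {Γ : Set ℂ} (hΓ : IsCompact Γ) :
    Tendsto (fun ε => volume (cthickening ε Γ \ Γ)) (𝓝 0) (𝓝 0) := by
  have h := ENNReal.Tendsto.sub (tendsto_measure_cthickening_of_isCompact (μ := volume) hΓ)
    (tendsto_const_nhds (x := volume Γ)) (Or.inl hΓ.measure_lt_top.ne)
  rw [tsub_self] at h
  refine h.congr fun ε => ?_
  rw [measure_sdiff (self_subset_cthickening Γ) hΓ.measurableSet.nullMeasurableSet
    hΓ.measure_lt_top.ne]

instance neBot_nhdsWithin_Ioc_zero_one : (𝓝[Ioc 0 1] (0 : ℝ)).NeBot :=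
  left_nhdsWithin_Ioc_neBot one_pos

lemma tendsto_deriv_of_eventually_close {Γ : Set ℂ} {Ω : ℝ → Set ℂ} {T : ℂ → ℂ}
    {Tε : ℝ → ℂ → ℂ} (hΓ : IsCompact Γ)
    (hΩ : ∀ ε ∈ Ioc (0 : ℝ) 1, Ω ε ⊆ {x : ℂ | ∃ y ∈ Γ, dist x y < ε})
    (hTε : ∀ ε ∈ Ioc (0 : ℝ) 1, DifferentiableOn ℂ (Tε ε) (closure (Ω ε))ᶜ)
    (hclose : ∀ R s : ℝ, 0 < s → ∀ᶠ ε in 𝓝[Ioc 0 1] (0 : ℝ), ∀ x ∈ (closure (Ω ε))ᶜ,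
      ‖x‖ ≤ R → ‖Tε ε x - T x‖ ≤ s) {y : ℂ} (hy : y ∈ Γᶜ) :
    Tendsto (fun ε => deriv (Tε ε) y) (𝓝[Ioc 0 1] (0 : ℝ)) (𝓝 (deriv T y)) := by
  obtain ⟨r, hr, hball⟩ := nhds_basis_closedBall.mem_iff.1 (hΓ.isClosed.isOpen_compl.mem_nhds hy)
  have hsub := eventually_subset_compl_closure hΓ hΩ (isCompact_closedBall y r) hball
  have hunif : TendstoUniformlyOn Tε T (𝓝[Ioc 0 1] (0 : ℝ)) (ball y r) := by
    rw [Metric.tendstoUniformlyOn_iff]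
    intro s hs
    filter_upwards [hsub, hclose (‖y‖ + r) (s / 2) (half_pos hs)] with ε hε hcl x hx
    have hxn : ‖x‖ ≤ ‖y‖ + r := by
      have h1 := norm_le_norm_add_norm_sub' x y
      have h2 : ‖x - y‖ < r := by simpa [dist_eq_norm] using hx
      linarith
    rw [dist_comm, dist_eq_norm]
    linarith [hcl x (hε (ball_subset_closedBall hx)) hxn]
  refine (hunif.tendstoLocallyUniformlyOn.deriv ?_ isOpen_ball).tendsto_at (mem_ball_self hr)
  filter_upwards [hsub, self_mem_nhdsWithin] with ε hε hmem
  exact (hTε ε hmem).mono (ball_subset_closedBall.trans hε)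

lemma norm_smul_transApply_le (L : ℂ →L[ℝ] ℂ) (w : ℂ) :
    ‖(1 / (2 * Real.pi)) • transApply L w‖ ≤ ‖L‖ * ‖w‖ := by
  have hpi := Real.pi_gt_three
  rw [norm_smul, Real.norm_of_nonneg (by positivity)]
  calc 1 / (2 * Real.pi) * ‖transApply L w‖ ≤ 1 / 2 * (2 * (‖L‖ * ‖w‖)) := by
        gcongr
        · linarith
        · exact norm_transApply_le L w
    _ = _ := by ring

lemma norm_velocity_sub_le (L L' : ℂ →L[ℝ] ℂ) (v v' : ℂ) :
    ‖(1 / (2 * Real.pi)) • transApply L' v' - (1 / (2 * Real.pi)) • transApply L v‖ ≤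
      ‖L' - L‖ * ‖v'‖ + ‖L‖ * ‖v' - v‖ := by
  have : (1 / (2 * Real.pi)) • transApply L' v' - (1 / (2 * Real.pi)) • transApply L v =
      (1 / (2 * Real.pi)) • transApply (L' - L) v' +
        (1 / (2 * Real.pi)) • transApply L (v' - v) := by
    rw [transApply_sub_left, transApply_sub, smul_sub, smul_sub]
    ring
  rw [this]
  exact (norm_add_le _ _).trans
    (add_le_add (norm_smul_transApply_le _ _) (norm_smul_transApply_le _ _))

lemma eLpNorm_two_eq_lintegral {E : Type*} [NormedAddCommGroup E] (f : ℂ → E) (μ : Measure ℂ) :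
    eLpNorm f 2 μ = (∫⁻ x, ‖f x‖ₑ ^ 2 ∂μ) ^ (1 / 2 : ℝ) := by
  rw [eLpNorm_eq_lintegral_rpow_enorm_toReal (by simp) (by simp)]
  simp

lemma tendsto_eLpNorm_two_of_three {E : Type*} [NormedAddCommGroup E] {ι : Type*}
    {l : Filter ι} {f : ι → ℂ → E} {Q B : Set ℂ} {U : ι → Set ℂ} (hQB : Q ⊆ B)
    (hB : volume B ≠ ∞) (hU : ∀ i, MeasurableSet (U i))
    (hf : ∀ i, StronglyMeasurable (f i))
    (h : Tendsto (fun i => eLpNorm (f i) 3 (volume.restrict (B ∩ U i))) l (𝓝 0)) :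
    Tendsto (fun i => eLpNorm ((U i).indicator (f i)) 2 (volume.restrict Q)) l (𝓝 0) := by
  have hlim : Tendsto (fun i => eLpNorm (f i) 3 (volume.restrict (B ∩ U i)) *
      volume B ^ (1 / 2 - 1 / 3 : ℝ)) l (𝓝 0) := by
    have := ENNReal.Tendsto.mul_const (b := volume B ^ (1 / 2 - 1 / 3 : ℝ)) h
      (Or.inr (ENNReal.rpow_ne_top_of_nonneg (by norm_num) hB))
    rwa [zero_mul] at this
  refine tendsto_of_tendsto_of_tendsto_of_le_of_le tendsto_const_nhds hlim
    (fun _ => zero_le) fun i => ?_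
  rw [eLpNorm_indicator_eq_eLpNorm_restrict (hU i), Measure.restrict_restrict (hU i),
    inter_comm (U i)]
  calc eLpNorm (f i) 2 (volume.restrict (Q ∩ U i))
      ≤ eLpNorm (f i) 2 (volume.restrict (B ∩ U i)) :=
        eLpNorm_mono_measure _ (Measure.restrict_mono (inter_subset_inter_left _ hQB) le_rfl)
    _ ≤ eLpNorm (f i) 3 (volume.restrict (B ∩ U i)) *
          volume.restrict (B ∩ U i) univ ^ (1 / (2 : ℝ≥0∞).toReal - 1 / (3 : ℝ≥0∞).toReal) :=
        eLpNorm_le_eLpNorm_mul_rpow_measure_univ (by norm_num) (hf i).aestronglyMeasurable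
    _ ≤ _ := by
        rw [Measure.restrict_apply_univ]
        simp only [ENNReal.toReal_ofNat]
        gcongr
        · exact inter_subset_left

lemma tendsto_eLpNorm_two_indicator_diff {E : Type*} [NormedAddCommGroup E] {Γ Q : Set ℂ}
    {f : ℂ → E} {Ω : ℝ → Set ℂ} (hΓ : IsCompact Γ)
    (hΩ : ∀ ε ∈ Ioc (0 : ℝ) 1, Ω ε ⊆ {x : ℂ | ∃ y ∈ Γ, dist x y < ε})
    (hfin : ∫⁻ x in Γᶜ ∩ Q, ‖f x‖ₑ ^ 2 ≠ ∞) :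
    Tendsto (fun ε => eLpNorm ((closure (Ω ε) \ Γ).indicator f) 2 (volume.restrict Q))
      (𝓝[Ioc 0 1] (0 : ℝ)) (𝓝 0) := by
  have hvol : Tendsto ((volume.restrict (Γᶜ ∩ Q)) ∘ fun ε => closure (Ω ε))
      (𝓝[Ioc 0 1] (0 : ℝ)) (𝓝 0) := by
    refine tendsto_of_tendsto_of_tendsto_of_le_of_le' tendsto_const_nhds
      ((tendsto_volume_cthickening_diff hΓ).mono_left nhdsWithin_le_nhds)
      (Eventually.of_forall fun _ => zero_le) ?_
    filter_upwards [self_mem_nhdsWithin] with ε hε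
    rw [Function.comp_apply, Measure.restrict_apply isClosed_closure.measurableSet]
    exact measure_mono fun x hx =>
      ⟨closure_subset_cthickening_of_subset (hΩ ε hε) hx.1, hx.2.1⟩
  have h := (ENNReal.continuous_rpow_const (y := (1 / 2 : ℝ))).continuousAt.tendsto.comp
    (tendsto_setLIntegral_zero hfin hvol)
  rw [ENNReal.zero_rpow_of_pos (by norm_num)] at h
  refine h.congr fun ε => ?_
  have hmeas : MeasurableSet (closure (Ω ε) \ Γ) :=
    isClosed_closure.measurableSet.diff hΓ.measurableSet
  rw [eLpNorm_indicator_eq_eLpNorm_restrict hmeas, Measure.restrict_restrict hmeas,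
    eLpNorm_two_eq_lintegral, Function.comp_apply,
    Measure.restrict_restrict isClosed_closure.measurableSet, sdiff_eq, inter_assoc]

lemma tendsto_zero_of_forall_eventually_le {ι : Type*} {l : Filter ι} {F e₁ e₃ : ι → ℝ≥0∞}
    {e₂ C : ℝ≥0∞} (hC : C ≠ ∞) (he₂ : e₂ ≠ ∞) (he₁ : Tendsto e₁ l (𝓝 0))
    (he₃ : Tendsto e₃ l (𝓝 0))
    (h : ∀ η : ℝ, 0 < η → ∀ᶠ i in l, F i ≤ C * e₁ i + ENNReal.ofReal η * e₂ + C * e₃ i) :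
    Tendsto F l (𝓝 0) := by
  rw [ENNReal.tendsto_nhds_zero]
  intro κ hκ
  have hlim₂ : Tendsto (fun η : ℝ => ENNReal.ofReal η * e₂) (𝓝[>] 0) (𝓝 0) := by
    have h0 : Tendsto (fun η : ℝ => ENNReal.ofReal η) (𝓝[>] 0) (𝓝 0) := by
      have := (ENNReal.continuous_ofReal.tendsto 0).mono_left
        (nhdsWithin_le_nhds (s := Ioi (0 : ℝ)))
      rwa [ENNReal.ofReal_zero] at this
    simpa using ENNReal.Tendsto.mul_const h0 (Or.inr he₂)
  have hκ2 : 0 < κ / 2 := ENNReal.half_pos hκ.ne'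
  obtain ⟨η, hη, hη0⟩ :=
    (((ENNReal.tendsto_nhds_zero.1 hlim₂) (κ / 2) hκ2).and self_mem_nhdsWithin).exists
  have hlim : Tendsto (fun i => C * e₁ i + C * e₃ i) l (𝓝 0) := by
    simpa using (ENNReal.Tendsto.const_mul he₁ (Or.inr hC)).add
      (ENNReal.Tendsto.const_mul he₃ (Or.inr hC))
  filter_upwards [h η hη0, ENNReal.tendsto_nhds_zero.1 hlim (κ / 2) hκ2] with i hi hi'
  calc F i ≤ C * e₁ i + ENNReal.ofReal η * e₂ + C * e₃ i := hi
    _ = (C * e₁ i + C * e₃ i) + ENNReal.ofReal η * e₂ := by ring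
    _ ≤ κ / 2 + κ / 2 := add_le_add hi' hη
    _ = κ := ENNReal.add_halves κ

lemma exists_one_lt_forall_le_norm {K : Set ℂ} {T : ℂ → ℂ} (hK : IsCompact K)
    (hT : ContinuousOn T K) (h1 : ∀ y ∈ K, 1 < ‖T y‖) : ∃ q > 1, ∀ y ∈ K, q ≤ ‖T y‖ := by
  rcases K.eq_empty_or_nonempty with rfl | hne
  · exact ⟨2, by norm_num, by simp⟩
  · obtain ⟨y₀, hy₀, hmin⟩ := hK.exists_isMinOn hne hT.norm
    exact ⟨‖T y₀‖, h1 y₀ hy₀, fun y hy => hmin hy⟩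

/-- The pointwise bound on the difference of the extended velocities integrates to a bound on
`L²(Q)`. -/
lemma eLpNorm_velocity_sub_le {Γ P Q : Set ℂ} {T T' N N' : ℂ → ℂ} {C η : ℝ} (hΓ : MeasurableSet Γ)
    (hP : MeasurableSet P) (hPΓ : P ⊆ Γᶜ) (hQ : MeasurableSet Q) (hC : 0 ≤ C) (hη : 0 ≤ η)
    (hN : ∀ x ∈ Γᶜ, ‖N x‖ ≤ C) (hN' : ∀ x ∈ P, ‖N' x‖ ≤ C)
    (hNN' : ∀ x ∈ P ∩ Q, ‖N' x - N x‖ ≤ η) :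
    eLpNorm (fun x =>
        P.indicator (fun x => (1 / (2 * Real.pi)) • transApply (fderiv ℝ T' x) (N' x)) x -
        Γᶜ.indicator (fun x => (1 / (2 * Real.pi)) • transApply (fderiv ℝ T x) (N x)) x)
        2 (volume.restrict Q) ≤
      ENNReal.ofReal C * eLpNorm (P.indicator fun x => fderiv ℝ T' x - fderiv ℝ T x) 2
          (volume.restrict Q) +
        ENNReal.ofReal η * eLpNorm (Γᶜ.indicator (fderiv ℝ T)) 2 (volume.restrict Q) +
        ENNReal.ofReal C * eLpNorm ((Pᶜ \ Γ).indicator (fderiv ℝ T)) 2 (volume.restrict Q) := by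
  set f₁ : ℂ → ℝ := fun x => ‖P.indicator (fun x => fderiv ℝ T' x - fderiv ℝ T x) x‖
  set f₂ : ℂ → ℝ := fun x => ‖Γᶜ.indicator (fderiv ℝ T) x‖
  set f₃ : ℂ → ℝ := fun x => ‖(Pᶜ \ Γ).indicator (fderiv ℝ T) x‖
  have hm : Measurable (fderiv ℝ T) := measurable_fderiv ℝ T
  have hm₁ : AEStronglyMeasurable f₁ (volume.restrict Q) :=
    (((measurable_fderiv ℝ T').sub hm).indicator hP).norm.aestronglyMeasurable
  have hm₂ : AEStronglyMeasurable f₂ (volume.restrict Q) :=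
    (hm.indicator hΓ.compl).norm.aestronglyMeasurable
  have hm₃ : AEStronglyMeasurable f₃ (volume.restrict Q) :=
    (hm.indicator (hP.compl.diff hΓ)).norm.aestronglyMeasurable
  have hbound : ∀ x ∈ Q,
      ‖P.indicator (fun x => (1 / (2 * Real.pi)) • transApply (fderiv ℝ T' x) (N' x)) x -
        Γᶜ.indicator (fun x => (1 / (2 * Real.pi)) • transApply (fderiv ℝ T x) (N x)) x‖ ≤
      (C • f₁ + η • f₂ + C • f₃) x := by
    intro x hxQ
    simp only [Pi.add_apply, Pi.smul_apply, smul_eq_mul, f₁, f₂, f₃]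
    by_cases hxP : x ∈ P
    · rw [indicator_of_mem hxP, indicator_of_mem (hPΓ hxP), indicator_of_mem hxP,
        indicator_of_mem (hPΓ hxP), indicator_of_notMem fun h => h.1 hxP, norm_zero, mul_zero,
        add_zero]
      refine (norm_velocity_sub_le _ _ _ _).trans ?_
      rw [mul_comm C, mul_comm η]
      gcongr
      · exact hN' x hxP
      · exact hNN' x ⟨hxP, hxQ⟩
    · by_cases hxΓ : x ∈ Γ
      · rw [indicator_of_notMem hxP, indicator_of_notMem (not_not.2 hxΓ), sub_zero, norm_zero]
        positivity
      · have hmem : x ∈ Pᶜ \ Γ := ⟨hxP, hxΓ⟩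
        rw [indicator_of_notMem hxP, indicator_of_mem (mem_compl hxΓ), zero_sub, norm_neg,
          indicator_of_mem hmem]
        refine le_add_of_nonneg_of_le (by positivity) ?_
        refine (norm_smul_transApply_le _ _).trans ?_
        rw [mul_comm C]
        gcongr
        exact hN x hxΓ
  refine (eLpNorm_mono_ae_real (ae_restrict_of_forall_mem hQ hbound)).trans ?_
  refine (eLpNorm_add_le ((hm₁.const_smul C).add (hm₂.const_smul η)) (hm₃.const_smul C)
    (by norm_num)).trans ?_
  refine (add_le_add_left (eLpNorm_add_le (hm₁.const_smul C) (hm₂.const_smul η)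
    (by norm_num)) _).trans (le_of_eq ?_)
  rw [eLpNorm_const_smul, eLpNorm_const_smul, eLpNorm_const_smul, Real.enorm_of_nonneg hC,
    Real.enorm_of_nonneg hη, eLpNorm_norm, eLpNorm_norm, eLpNorm_norm]

/-- Convergence in `L²_loc` of the initial velocities
`u₀^ε = K_{T_ε}[ω₀] + α H_{T_ε}` (extended by 0) to `u₀ = K_T[ω₀] + α H_T` (extended by 0)
as the obstacle `Ω_ε` shrinks to the curve `Γ`. -/
theorem initial_velocity_L2loc_convergence
    (RΓ : ℝ) (hRΓ : 0 < RΓ) (Γ : Set ℂ) (hΓc : IsCompact Γ)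
    (hΓb : Γ ⊆ Metric.ball 0 RΓ)
    (T h : ℂ → ℂ) (β : ℂ) (hβ : β ≠ 0) (M : ℝ)
    (hT : DifferentiableOn ℂ T Γᶜ)
    (hTbij : Set.BijOn T Γᶜ {z : ℂ | 1 < ‖z‖})
    (hT1 : ∀ z ∈ Γᶜ, 1 ≤ ‖T z‖)
    (hh : DifferentiableOn ℂ h Γᶜ) (hhb : ∀ z ∈ Γᶜ, ‖h z‖ ≤ M)
    (hform : ∀ z ∈ Γᶜ, T z = β * z + h z)
    (ω₀ : ℂ → ℝ) (hω : ContDiff ℝ (⊤ : ℕ∞) ω₀) (hωc : HasCompactSupport ω₀)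
    (hωs : tsupport ω₀ ⊆ Γᶜ)
    (α : ℝ)
    (Ω : ℝ → Set ℂ) (Tε Sε : ℝ → ℂ → ℂ)
    (hΩ : ∀ ε ∈ Set.Ioc (0:ℝ) 1,
      IsOpen (Ω ε) ∧ Bornology.IsBounded (Ω ε) ∧ Γ ⊆ Ω ε ∧
      Ω ε ⊆ {x : ℂ | ∃ y ∈ Γ, dist x y < ε} ∧
      tsupport ω₀ ∩ closure (Ω ε) = ∅)
    (hTε : ∀ ε ∈ Set.Ioc (0:ℝ) 1,
      DifferentiableOn ℂ (Tε ε) (closure (Ω ε))ᶜ ∧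
      Set.BijOn (Tε ε) (closure (Ω ε))ᶜ {z : ℂ | 1 < ‖z‖} ∧
      ∀ z ∈ (closure (Ω ε))ᶜ, 1 ≤ ‖Tε ε z‖)
    -- (i) sup over Π_ε of |T_ε − T|/|T| tends to 0
    (hi : ∀ η : ℝ, 0 < η → ∀ᶠ ε in nhdsWithin 0 (Set.Ioc (0:ℝ) 1),
      ∀ x ∈ (closure (Ω ε))ᶜ, ‖Tε ε x - T x‖ / ‖T x‖ ≤ η)
    -- (ii) uniform bound on |det D(T_ε⁻¹)|
    (M' : ℝ)
    (hSε : ∀ ε ∈ Set.Ioc (0:ℝ) 1, ∀ z : ℂ, 1 < ‖z‖ →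
      Sε ε z ∈ (closure (Ω ε))ᶜ ∧ Tε ε (Sε ε z) = z ∧
      |LinearMap.det ((fderiv ℝ (Sε ε) z : ℂ →ₗ[ℝ] ℂ))| ≤ M')
    -- (iii) ‖DT_ε − DT‖_{L³(B(0,R) ∩ Π_ε)} → 0
    (hiii : ∀ R : ℝ, 0 < R →
      Filter.Tendsto
        (fun ε => eLpNorm (fun x => fderiv ℝ (Tε ε) x - fderiv ℝ T x) 3
          (volume.restrict (Metric.ball 0 R ∩ (closure (Ω ε))ᶜ)))
        (nhdsWithin 0 (Set.Ioc (0:ℝ) 1)) (nhds 0))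
    -- (iv) uniform bound on DT_ε outside a large ball
    (R₁ C₀ : ℝ) (hR₁ : 0 < R₁) (hC₀ : 0 < C₀)
    (hiv : ∀ ε ∈ Set.Ioc (0:ℝ) 1, ∀ x : ℂ, R₁ ≤ ‖x‖ → ‖fderiv ℝ (Tε ε) x‖ ≤ C₀) :
    ∀ Q : Set ℂ, IsCompact Q →
      Filter.Tendsto
        (fun ε => eLpNorm
          (fun x =>
            Set.indicator (closure (Ω ε))ᶜ
              (fun x => KT (Tε ε) ω₀ x + α • HT (Tε ε) x) x
            - Set.indicator Γᶜ (fun x => KT T ω₀ x + α • HT T x) x)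
          2 (volume.restrict Q))
        (nhdsWithin 0 (Set.Ioc (0:ℝ) 1)) (nhds 0) := by
  have hΓo : IsOpen Γᶜ := hΓc.isClosed.isOpen_compl
  have hΩs : ∀ ε ∈ Ioc (0 : ℝ) 1, Ω ε ⊆ {x : ℂ | ∃ y ∈ Γ, dist x y < ε} :=
    fun ε hε => (hΩ ε hε).2.2.2.1
  have hPΓ : ∀ ε ∈ Ioc (0 : ℝ) 1, (closure (Ω ε))ᶜ ⊆ Γᶜ := fun ε hε =>
    compl_subset_compl.2 ((hΩ ε hε).2.2.1.trans subset_closure)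
  have hPo : ∀ ε, IsOpen (closure (Ω ε))ᶜ := fun ε => isClosed_closure.isOpen_compl
  have hTbound : ∀ (R : ℝ), ∀ x ∈ Γᶜ, ‖x‖ ≤ R → ‖T x‖ ≤ ‖β‖ * R + |M| + 1 := by
    intro R x hx hxR
    have h1 : ‖T x‖ ≤ ‖β‖ * ‖x‖ + ‖h x‖ := by
      rw [hform x hx, ← norm_mul]
      exact norm_add_le _ _
    have h2 : ‖β‖ * ‖x‖ ≤ ‖β‖ * R := by gcongr
    linarith [hhb x hx, le_abs_self M]
  have hclose : ∀ R s : ℝ, 0 < s → ∀ᶠ ε in 𝓝[Ioc 0 1] (0 : ℝ), ∀ x ∈ (closure (Ω ε))ᶜ,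
      ‖x‖ ≤ R → ‖Tε ε x - T x‖ ≤ s := by
    intro R s hs
    have hB : 0 < ‖β‖ * |R| + |M| + 1 := by positivity
    filter_upwards [hi (s / (‖β‖ * |R| + |M| + 1)) (by positivity), self_mem_nhdsWithin]
      with ε hε hmem x hx hxR
    have h1 := hT1 x (hPΓ ε hmem hx)
    have h2 := hTbound |R| x (hPΓ ε hmem hx) (hxR.trans (le_abs_self R))
    have h3 := (div_le_iff₀ (by linarith)).1 (hε x hx)
    calc _ ≤ _ := h3
      _ ≤ s / (‖β‖ * |R| + |M| + 1) * (‖β‖ * |R| + |M| + 1) := by gcongr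
      _ = s := div_mul_cancel₀ _ hB.ne'
  have hM'0 : 0 ≤ M' :=
    (abs_nonneg _).trans (hSε 1 (by simp) 2 (by simp)).2.2
  have hderivε : ∀ ε ∈ Ioc (0 : ℝ) 1, ∀ y ∈ (closure (Ω ε))ᶜ,
      1 ≤ M' * ‖deriv (Tε ε) y‖ ^ 2 := by
    intro ε hε y hy
    obtain ⟨hd, hbij, -⟩ := hTε ε hε
    refine one_le_mul_norm_deriv_sq (hPo ε) hd hbij.injOn (g := Sε ε) (fun z hz => ?_)
      (fun z hz => (hSε ε hε _ (hbij.mapsTo hz)).2.2) hy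
    have := hSε ε hε _ (hbij.mapsTo hz)
    exact hbij.injOn this.1 hz this.2.1
  have hderiv : ∀ y ∈ Γᶜ, 1 ≤ M' * ‖deriv T y‖ ^ 2 := by
    intro y hy
    have hlim := tendsto_deriv_of_eventually_close hΓc hΩs (fun ε hε => (hTε ε hε).1) hclose hy
    refine ge_of_tendsto ((hlim.norm.pow 2).const_mul M') ?_
    filter_upwards [self_mem_nhdsWithin, eventually_subset_compl_closure hΓc hΩs
      isCompact_singleton (singleton_subset_iff.2 hy)] with ε hε hyε
    exact hderivε ε hε y (hyε rfl)
  set K := tsupport ω₀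
  have hK : IsCompact K := hωc
  have hωK : ∀ y ∉ K, ω₀ y = 0 := fun y hy => image_eq_zero_of_notMem_tsupport hy
  obtain ⟨W, hW⟩ := hωc.exists_bound_of_continuous hω.continuous
  obtain ⟨q₀, hq₀, hq₀T⟩ := exists_one_lt_forall_le_norm hK (hT.continuousOn.mono hωs)
    fun y hy => hTbij.mapsTo (hωs hy)
  obtain ⟨q, hq, hqq₀⟩ := exists_between hq₀
  have hcT : ControlledOn K M' q T :=
    ⟨hT.continuousOn.mono hωs, lintegral_comp_le_of_le_deriv hΓo hT hTbij.injOn hωs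
      hK.measurableSet hderiv, fun y hy => hqq₀.le.trans (hq₀T y hy)⟩
  obtain ⟨RK, hRK⟩ := hK.isBounded.exists_norm_le
  have hKP : ∀ ε ∈ Ioc (0 : ℝ) 1, K ⊆ (closure (Ω ε))ᶜ := fun ε hε =>
    (disjoint_iff_inter_eq_empty.2 (hΩ ε hε).2.2.2.2).subset_compl_right
  have hcTε : ∀ᶠ ε in 𝓝[Ioc 0 1] (0 : ℝ), ControlledOn K M' q (Tε ε) := by
    filter_upwards [self_mem_nhdsWithin, hclose RK (q₀ - q) (sub_pos.2 hqq₀)] with ε hε hcl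
    obtain ⟨hd, hbij, -⟩ := hTε ε hε
    refine ⟨hd.continuousOn.mono (hKP ε hε), lintegral_comp_le_of_le_deriv (hPo ε) hd hbij.injOn
      (hKP ε hε) hK.measurableSet (hderivε ε hε), fun y hy => ?_⟩
    have h1 := hcl y (hKP ε hε hy) (hRK y hy)
    have h2 := norm_le_norm_add_norm_sub (Tε ε y) (T y)
    linarith [hq₀T y hy]
  intro Q hQ
  obtain ⟨RQ, hRQ⟩ := hQ.isBounded.exists_norm_le
  have hfin : ∫⁻ x in Γᶜ ∩ Q, ‖fderiv ℝ T x‖ₑ ^ 2 ≠ ∞ := by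
    rw [lintegral_enorm_fderiv_sq hΓo hT hTbij.injOn inter_subset_left
      (hΓo.measurableSet.inter hQ.measurableSet)]
    refine ne_top_of_le_ne_top (measure_closedBall_lt_top (μ := volume) (x := (0 : ℂ))
      (r := ‖β‖ * RQ + |M| + 1)).ne (measure_mono ?_)
    rintro _ ⟨x, hx, rfl⟩
    simpa using hTbound RQ x hx.1 (hRQ x hx.2)
  have he₂ : eLpNorm (Γᶜ.indicator (fderiv ℝ T)) 2 (volume.restrict Q) ≠ ∞ := by
    rw [eLpNorm_indicator_eq_eLpNorm_restrict hΓo.measurableSet,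
      Measure.restrict_restrict hΓo.measurableSet, eLpNorm_two_eq_lintegral]
    exact ENNReal.rpow_ne_top_of_nonneg (by norm_num) hfin
  have hQB : Q ⊆ ball 0 (|RQ| + 1) := fun x hx => by
    rw [mem_ball_zero_iff]
    linarith [hRQ x hx, le_abs_self RQ]
  have he₁ := tendsto_eLpNorm_two_of_three hQB measure_ball_lt_top.ne
    (fun ε => (hPo ε).measurableSet)
    (fun ε => ((measurable_fderiv ℝ (Tε ε)).sub (measurable_fderiv ℝ T)).stronglyMeasurable)
    (hiii (|RQ| + 1) (by positivity))
  have he₃ := tendsto_eLpNorm_two_indicator_diff hΓc hΩs hfin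
  simp only [velocity_eq]
  obtain ⟨C, hC⟩ : ∃ C, C = W * (volume.real K + M' * (2 * Real.pi) +
      (1 - q⁻¹)⁻¹ * volume.real K) + |α| := ⟨_, rfl⟩
  refine tendsto_zero_of_forall_eventually_le (C := ENNReal.ofReal C) ENNReal.ofReal_ne_top
    he₂ he₁ he₃ fun η hη => ?_
  obtain ⟨s, hs, hpot⟩ :=
    exists_norm_potentialFactor_sub_le hK hq hM'0 hω.continuous hωK hW α hη
  filter_upwards [self_mem_nhdsWithin, hcTε, hclose RK s hs, hclose RQ s hs]
    with ε hε hc hclK hclQ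
  have hNT : ∀ x ∈ Γᶜ, ‖potentialFactor T ω₀ α x‖ ≤ C := fun x hx =>
    hC ▸ hcT.norm_potentialFactor_le hK hq hM'0 hωK hW α (hT1 x hx)
  have h2 : (2 : ℂ) ∈ {z : ℂ | 1 < ‖z‖} := by simp
  obtain ⟨x₀, hx₀, -⟩ := hTbij.surjOn h2
  have hC0 := (norm_nonneg _).trans (hNT x₀ hx₀)
  have := eLpNorm_velocity_sub_le (T := T) (T' := Tε ε) (N := potentialFactor T ω₀ α)
    (N' := potentialFactor (Tε ε) ω₀ α) hΓc.measurableSet (hPo ε).measurableSet (hPΓ ε hε)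
    hQ.measurableSet hC0 hη.le hNT
    (fun x hx => hC ▸ hc.norm_potentialFactor_le hK hq hM'0 hωK hW α ((hTε ε hε).2.2 x hx))
    (fun x hx => hpot T (Tε ε) hcT hc x (hT1 x (hPΓ ε hε hx.1)) ((hTε ε hε).2.2 x hx.1)
      (hclQ x hx.1 (hRQ x hx.2)) fun y hy => hclK y (hKP ε hε hy) (hRK y hy))
  rwa [compl_compl] at this

end
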